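/- Let q ≥ 2, let F_q be a finite field with q elements, let ν_i be the number of monic irreducible polynomials of degree i over F_q, and let e_{n,k} be the number of monic polynomials of degree n over F_q with excess k. For every complex number z with |z| < √q, the double series ∑_{n≥0, k≥0} (e_{n,k} − q·e_{n−1,k}) · q^{−n} · z^k (with e_{−1,k} = 0) converges and equals the absolutely convergent product ∏_{i≥1} (1 − q^{−i})^{ν_i} · (1 + q^{−i}/(1 − q^{−i} z))^{ν_i}. -/

import Mathlib

open Polynomial Filter Topology

open scoped Classical in
/-- The excess of a polynomial over a field: total multiplicity of its irreducible
factorization minus the number of distinct irreducible factors. -/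
noncomputable def excess {Fq : Type*} [Field Fq] (f : Polynomial Fq) : ℕ :=
  (UniqueFactorizationMonoid.normalizedFactors f).card -
    (UniqueFactorizationMonoid.normalizedFactors f).toFinset.card

/-- `excessCount Fq n k` is the number of monic polynomials of degree `n` over `Fq`
with excess `k` (the quantity `e_{n,k}`). -/
noncomputable def excessCount (Fq : Type*) [Field Fq] (n k : ℕ) : ℕ :=
  {f : Polynomial Fq | f.Monic ∧ f.natDegree = n ∧ excess f = k}.ncard

/-- `nu Fq i` is the number of monic irreducible polynomials of degree `i` over `Fq`. -/
noncomputable def nu (Fq : Type*) [Field Fq] (i : ℕ) : ℕ :=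
  {p : Polynomial Fq | p.Monic ∧ Irreducible p ∧ p.natDegree = i}.ncard

/-- `sqfCount Fq n` is the number of squarefree monic polynomials of degree `n` over `Fq`
(the quantity `e_{n,0}`). -/
noncomputable def sqfCount (Fq : Type*) [Field Fq] (n : ℕ) : ℕ :=
  {f : Polynomial Fq | f.Monic ∧ f.natDegree = n ∧ Squarefree f}.ncard

theorem aux_sum_finsupp {ι R : Type*} [CommSemiring R] (w : ι → ℕ → R) (hw : ∀ i, w i 0 = 1)
    (s : Finset ι) (t : ι → Finset ℕ) :
    ∑ φ ∈ s.finsupp t, φ.prod w = ∏ i ∈ s, ∑ j ∈ t i, w i j := by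
  classical
  rw [Finset.prod_sum, Finset.finsupp, Finset.sum_map]
  refine Finset.sum_congr (by congr!) fun p _ => ?_
  change (Finsupp.indicator s p).prod w = _
  rw [Finsupp.prod_of_support_subset _ (s := s) (Finsupp.support_indicator_subset _ _) _
    (fun i _ => hw i), ← Finset.prod_attach s]
  refine Finset.prod_congr rfl fun x _ => ?_
  congr 1
  exact Finsupp.indicator_of_mem x.2 _

theorem aux_euler_summable {ι : Type*} (w : ι → ℕ → ℂ) (hw : ∀ i, w i 0 = 1)
    (b : ι → ℝ) (hb : ∀ i, HasSum (fun m => ‖w i (m + 1)‖) (b i)) (hs : Summable b) :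
    Summable (fun φ : ι →₀ ℕ => ‖φ.prod w‖) := by
  classical
  have hb0 : ∀ i, 0 ≤ b i := fun i => (hb i).nonneg fun _ => norm_nonneg _
  refine summable_of_sum_le (c := Real.exp (∑' i, b i)) (fun _ => norm_nonneg _) fun u => ?_
  let s : Finset ι := u.biUnion Finsupp.support
  let N : ℕ := u.sup (fun φ => φ.support.sup φ) + 1
  have hsub : u ⊆ s.finsupp (fun _ => Finset.range (N + 1)) := by
    intro φ hφ
    rw [Finset.mem_finsupp_iff]
    refine ⟨Finset.subset_biUnion_of_mem _ hφ, fun i _ => ?_⟩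
    by_cases hi : i ∈ φ.support
    · have h1 : φ i ≤ φ.support.sup φ := Finset.le_sup hi
      have h2 : φ.support.sup φ ≤ u.sup (fun φ => φ.support.sup φ) :=
        Finset.le_sup (f := fun φ : ι →₀ ℕ => φ.support.sup φ) hφ
      simp only [Finset.mem_range]; omega
    · rw [Finsupp.notMem_support_iff] at hi
      simp [hi]
  calc ∑ φ ∈ u, ‖φ.prod w‖ ≤ ∑ φ ∈ s.finsupp (fun _ => Finset.range (N + 1)), ‖φ.prod w‖ :=
        Finset.sum_le_sum_of_subset_of_nonneg hsub fun _ _ _ => norm_nonneg _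
    _ = ∑ φ ∈ s.finsupp (fun _ => Finset.range (N + 1)), φ.prod (fun i m => ‖w i m‖) := by
        refine Finset.sum_congr rfl fun φ _ => ?_
        simp [Finsupp.prod, norm_prod]
    _ = ∏ i ∈ s, ∑ j ∈ Finset.range (N + 1), ‖w i j‖ :=
        aux_sum_finsupp (fun i m => ‖w i m‖) (by simp [hw]) _ _
    _ ≤ ∏ i ∈ s, Real.exp (b i) := by
        refine Finset.prod_le_prod (fun i _ => Finset.sum_nonneg fun _ _ => norm_nonneg _)
          fun i _ => ?_
        rw [Finset.sum_range_succ', hw, norm_one]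
        have := sum_le_hasSum (Finset.range N) (fun _ _ => norm_nonneg _) (hb i)
        linarith [Real.add_one_le_exp (b i)]
    _ = Real.exp (∑ i ∈ s, b i) := (Real.exp_sum _ _).symm
    _ ≤ Real.exp (∑' i, b i) := Real.exp_le_exp.2 (hs.sum_le_tsum _ fun i _ => hb0 i)

theorem aux_euler_hasProd {ι : Type*} (w : ι → ℕ → ℂ) (hw : ∀ i, w i 0 = 1)
    (c : ι → ℂ) (hc : ∀ i, HasSum (w i) (c i))
    (hs : Summable (fun φ : ι →₀ ℕ => ‖φ.prod w‖)) :
    HasProd c (∑' φ : ι →₀ ℕ, φ.prod w) := by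
  classical
  have hS : HasSum (fun φ : ι →₀ ℕ => φ.prod w) (∑' φ : ι →₀ ℕ, φ.prod w) := hs.of_norm.hasSum
  set S := ∑' φ : ι →₀ ℕ, φ.prod w
  rw [HasProd, SummationFilter.unconditional_filter, Metric.tendsto_atTop]
  intro ε hε
  rw [HasSum, SummationFilter.unconditional_filter, Metric.tendsto_atTop] at hS
  obtain ⟨u, hu⟩ := hS (ε / 2) (by positivity)
  refine ⟨u.biUnion Finsupp.support, fun s hsu => ?_⟩
  have hlim : Tendsto (fun N => ∏ i ∈ s, ∑ j ∈ Finset.range N, w i j) atTop (𝓝 (∏ i ∈ s, c i)) :=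
    tendsto_finsetProd _ fun i _ => (hc i).tendsto_sum_nat
  have hle : dist (∏ i ∈ s, c i) S ≤ ε / 2 := by
    refine le_of_tendsto (hlim.dist tendsto_const_nhds) ?_
    filter_upwards [eventually_ge_atTop (u.sup (fun φ => φ.support.sup φ) + 1)] with N hN
    rw [← aux_sum_finsupp w hw s (fun _ => Finset.range N)]
    refine (hu _ ?_).le
    intro φ hφ
    rw [Finset.mem_finsupp_iff]
    refine ⟨(Finset.subset_biUnion_of_mem _ hφ).trans hsu, fun i _ => ?_⟩
    by_cases hi : i ∈ φ.support
    · have h1 : φ i ≤ φ.support.sup φ := Finset.le_sup hi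
      have h2 : φ.support.sup φ ≤ u.sup (fun φ => φ.support.sup φ) :=
        Finset.le_sup (f := fun φ : ι →₀ ℕ => φ.support.sup φ) hφ
      simp only [Finset.mem_range]; omega
    · rw [Finsupp.notMem_support_iff] at hi
      simp only [hi, Finset.mem_range]; omega
  linarith

/-- Weights. -/
noncomputable def wP (m : ℕ) : ℤ[X] :=
  match m with
  | 0 => 1
  | 1 => 0
  | m + 2 => X ^ (m + 1) - X ^ m

noncomputable def wN (m : ℕ) : ℤ[X] :=
  match m with
  | 0 => 1
  | 1 => 0
  | m + 2 => X ^ (m + 1) + X ^ m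

theorem aux_sum_wP (m : ℕ) : ∑ j ∈ Finset.range (m + 1), wP j = X ^ (m - 1) := by
  induction m with
  | zero => simp [wP]
  | succ m ih =>
    rw [Finset.sum_range_succ, ih]
    cases m with
    | zero => simp [wP]
    | succ m => simp [wP]

theorem aux_wP_le (m k : ℕ) : |(wP m).coeff k| ≤ (wN m).coeff k := by
  match m with
  | 0 => simp [wP, wN, coeff_one]; split_ifs <;> simp
  | 1 => simp [wP, wN]
  | m + 2 =>
    simp only [wP, wN, coeff_sub, coeff_add, coeff_X_pow]
    split_ifs <;> simp

theorem aux_prod_le {ι : Type*} (s : Finset ι) (f g : ι → ℤ[X])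
    (h : ∀ i k, |(f i).coeff k| ≤ (g i).coeff k) (k : ℕ) :
    |(∏ i ∈ s, f i).coeff k| ≤ (∏ i ∈ s, g i).coeff k := by
  classical
  induction s using Finset.induction generalizing k with
  | empty => simp [coeff_one]; split_ifs <;> simp
  | insert a s ha ih =>
    rw [Finset.prod_insert ha, Finset.prod_insert ha, coeff_mul, coeff_mul]
    refine (Finset.abs_sum_le_sum_abs _ _).trans (Finset.sum_le_sum fun x _ => ?_)
    rw [abs_mul]
    exact mul_le_mul (h _ _) (ih _) (abs_nonneg _) ((abs_nonneg _).trans (h _ _))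

abbrev MIrr (Fq : Type*) [Field Fq] : Type _ := {p : Polynomial Fq // p.Monic ∧ Irreducible p}

noncomputable def toPoly {Fq : Type*} [Field Fq] (φ : MIrr Fq →₀ ℕ) : Polynomial Fq :=
  (φ.toMultiset.map Subtype.val).prod

noncomputable def fdeg {Fq : Type*} [Field Fq] (φ : MIrr Fq →₀ ℕ) : ℕ :=
  φ.sum (fun p m => m * p.1.natDegree)

theorem fdeg_add {Fq : Type*} [Field Fq] (φ ψ : MIrr Fq →₀ ℕ) :
    fdeg (φ + ψ) = fdeg φ + fdeg ψ := by
  classical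
  exact Finsupp.sum_add_index' (by simp) (by intros; ring)

theorem toPoly_monic {Fq : Type*} [Field Fq] (φ : MIrr Fq →₀ ℕ) : (toPoly φ).Monic := by
  refine monic_multiset_prod_of_monic _ _ fun p _ => p.2.1

theorem toPoly_natDegree {Fq : Type*} [Field Fq] (φ : MIrr Fq →₀ ℕ) :
    (toPoly φ).natDegree = fdeg φ := by
  rw [toPoly, natDegree_multiset_prod_of_monic]
  · rw [Multiset.map_map, fdeg, Finsupp.toMultiset_apply, Finsupp.sum, Finsupp.sum]
    rw [← Multiset.coe_mapAddMonoidHom, map_sum, ← Multiset.coe_sumAddMonoidHom, map_sum]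
    simp [Multiset.map_nsmul, Multiset.sum_nsmul]
  · intro f hf
    obtain ⟨p, _, rfl⟩ := Multiset.mem_map.1 hf
    exact p.2.1

open scoped Classical in
theorem toPoly_factors {Fq : Type*} [Field Fq] (φ : MIrr Fq →₀ ℕ) :
    UniqueFactorizationMonoid.normalizedFactors (toPoly φ) = φ.toMultiset.map Subtype.val := by
  rw [toPoly, UniqueFactorizationMonoid.normalizedFactors_prod_eq, Multiset.map_map]
  · refine Multiset.map_congr rfl fun p _ => ?_
    exact p.2.1.normalize_eq_self
  · intro f hf
    obtain ⟨p, _, rfl⟩ := Multiset.mem_map.1 hf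
    exact p.2.2

theorem toPoly_injective {Fq : Type*} [Field Fq] :
    Function.Injective (toPoly : (MIrr Fq →₀ ℕ) → Polynomial Fq) := by
  classical
  intro φ ψ h
  have h1 := toPoly_factors φ
  rw [h, toPoly_factors ψ] at h1
  have := Multiset.map_injective Subtype.val_injective h1
  exact (Multiset.toFinsupp.symm.injective this).symm

theorem toPoly_surj {Fq : Type*} [Field Fq] (f : Polynomial Fq) (hf : f.Monic) :
    ∃ φ : MIrr Fq →₀ ℕ, toPoly φ = f := by
  classical
  have hm : ∀ p ∈ UniqueFactorizationMonoid.normalizedFactors f, p.Monic ∧ Irreducible p := by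
    intro p hp
    rw [Polynomial.mem_normalizedFactors_iff hf.ne_zero] at hp
    exact ⟨hp.2.1, hp.1⟩
  refine ⟨Multiset.toFinsupp ((UniqueFactorizationMonoid.normalizedFactors f).pmap Subtype.mk hm), ?_⟩
  rw [toPoly, Multiset.toFinsupp_toMultiset, Multiset.map_pmap]
  simp only [Multiset.pmap_eq_map, Multiset.map_id']
  have := leadingCoeff_mul_prod_normalizedFactors f
  rwa [hf.leadingCoeff, map_one, one_mul] at this

noncomputable def fexc {Fq : Type*} [Field Fq] (φ : MIrr Fq →₀ ℕ) : ℕ :=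
  φ.sum (fun _ m => m - 1)

theorem toPoly_excess {Fq : Type*} [Field Fq] (φ : MIrr Fq →₀ ℕ) :
    excess (toPoly φ) = fexc φ := by
  classical
  rw [excess, toPoly_factors, Multiset.card_map, Finsupp.card_toMultiset]
  have : (Multiset.map Subtype.val (Finsupp.toMultiset φ)).toFinset.card = φ.support.card := by
    rw [Multiset.toFinset_map, Finset.card_image_of_injective _ Subtype.val_injective,
      Finsupp.toFinset_toMultiset]
  have h2 : fexc φ + φ.support.card = φ.sum fun _ => id := by
    rw [fexc, Finsupp.sum, Finsupp.sum, Finset.card_eq_sum_ones, ← Finset.sum_add_distrib]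
    refine Finset.sum_congr rfl fun p hp => ?_
    have := Finsupp.mem_support_iff.1 hp
    simp only [id]; omega
  convert Nat.sub_eq_of_eq_add h2.symm

theorem monic_card (Fq : Type*) [Field Fq] [Fintype Fq] (n : ℕ) :
    {f : Polynomial Fq | f.Monic ∧ f.natDegree = n}.ncard = Fintype.card Fq ^ n := by
  have e : {f : Polynomial Fq | f.Monic ∧ f.natDegree = n} ≃ (Fin n → Fq) :=
    (monicEquivDegreeLT n).trans (degreeLTEquiv Fq n).toEquiv
  rw [← Nat.card_coe_set_eq, Nat.card_congr e]
  simp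

theorem monic_finite (Fq : Type*) [Field Fq] [Fintype Fq] (n : ℕ) :
    {f : Polynomial Fq | f.Monic ∧ f.natDegree = n}.Finite := by
  have e : {f : Polynomial Fq | f.Monic ∧ f.natDegree = n} ≃ (Fin n → Fq) :=
    (monicEquivDegreeLT n).trans (degreeLTEquiv Fq n).toEquiv
  have := Finite.of_equiv _ e.symm
  exact Set.toFinite _

theorem nu_le (Fq : Type*) [Field Fq] [Fintype Fq] (n : ℕ) : nu Fq n ≤ Fintype.card Fq ^ n := by
  rw [← monic_card]
  exact Set.ncard_le_ncard (fun f hf => ⟨hf.1, hf.2.2⟩) (monic_finite Fq n)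

theorem fdeg_finite (Fq : Type*) [Field Fq] [Fintype Fq] (n : ℕ) :
    {φ : MIrr Fq →₀ ℕ | fdeg φ = n}.Finite := by
  refine Set.Finite.of_finite_image (f := toPoly) ((monic_finite Fq n).subset ?_)
    toPoly_injective.injOn
  rintro _ ⟨φ, hφ, rfl⟩
  exact ⟨toPoly_monic φ, (toPoly_natDegree φ).trans hφ⟩

noncomputable def DD (Fq : Type*) [Field Fq] [Fintype Fq] (n : ℕ) : Finset (MIrr Fq →₀ ℕ) :=
  (fdeg_finite Fq n).toFinset

theorem mem_DD {Fq : Type*} [Field Fq] [Fintype Fq] {n : ℕ} {φ : MIrr Fq →₀ ℕ} :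
    φ ∈ DD Fq n ↔ fdeg φ = n := by simp [DD]

theorem DD_card (Fq : Type*) [Field Fq] [Fintype Fq] (n : ℕ) :
    (DD Fq n).card = Fintype.card Fq ^ n := by
  rw [← monic_card, ← Set.ncard_coe_finset, ← Set.ncard_image_of_injective _ toPoly_injective]
  congr 1
  ext f
  constructor
  · rintro ⟨φ, hφ, rfl⟩
    exact ⟨toPoly_monic φ, (toPoly_natDegree φ).trans (mem_DD.1 hφ)⟩
  · rintro ⟨hf, hn⟩
    obtain ⟨φ, rfl⟩ := toPoly_surj f hf
    exact ⟨φ, mem_DD.2 (by rw [← toPoly_natDegree, hn]), rfl⟩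

theorem excessCount_eq (Fq : Type*) [Field Fq] [Fintype Fq] (n k : ℕ) :
    (excessCount Fq n k : ℤ) = (∑ φ ∈ DD Fq n, (X : ℤ[X]) ^ fexc φ).coeff k := by
  classical
  have : excessCount Fq n k = ((DD Fq n).filter (fun φ => k = fexc φ)).card := by
    rw [excessCount, ← Set.ncard_coe_finset, ← Set.ncard_image_of_injective _ toPoly_injective]
    congr 1
    ext f
    constructor
    · rintro ⟨hf, hn, hk⟩
      obtain ⟨φ, rfl⟩ := toPoly_surj f hf
      refine ⟨φ, ?_, rfl⟩
      simp only [Finset.coe_filter, Set.mem_ofPred_eq, mem_DD]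
      exact ⟨by rw [← toPoly_natDegree, hn], by rw [← toPoly_excess, hk]⟩
    · rintro ⟨φ, hφ, rfl⟩
      simp only [Finset.coe_filter, Set.mem_ofPred_eq, mem_DD] at hφ
      exact ⟨toPoly_monic φ, (toPoly_natDegree φ).trans hφ.1, (toPoly_excess φ).trans hφ.2.symm⟩
  rw [this, finsetSum_coeff]
  simp [coeff_X_pow]

noncomputable def HH {Fq : Type*} [Field Fq] (φ : MIrr Fq →₀ ℕ) : ℤ[X] :=
  φ.prod (fun _ m => wP m)

theorem X_pow_fexc {Fq : Type*} [Field Fq] (φ : MIrr Fq →₀ ℕ) :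
    (X : ℤ[X]) ^ fexc φ = ∑ ψ ∈ φ.support.finsupp (fun i => Finset.range (φ i + 1)), HH ψ := by
  unfold HH
  rw [aux_sum_finsupp (fun _ m => wP m) (fun _ => rfl), fexc, Finsupp.sum,
    ← Finset.prod_pow_eq_pow_sum]
  exact Finset.prod_congr rfl fun i _ => (aux_sum_wP _).symm

theorem mem_below {ι : Type*} (φ ψ : ι →₀ ℕ) :
    ψ ∈ φ.support.finsupp (fun i => Finset.range (φ i + 1)) ↔ ψ ≤ φ := by
  rw [Finset.mem_finsupp_iff]
  constructor
  · rintro ⟨h1, h2⟩ i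
    by_cases hi : i ∈ φ.support
    · exact Nat.lt_succ_iff.1 (Finset.mem_range.1 (h2 i hi))
    · rw [Finsupp.notMem_support_iff.1 (fun h => hi (h1 h))]; exact Nat.zero_le _
  · intro h
    exact ⟨Finsupp.support_mono h, fun i _ => Finset.mem_range.2 (Nat.lt_succ_iff.2 (h i))⟩

theorem sum_convolution (Fq : Type*) [Field Fq] [Fintype Fq] (n : ℕ) :
    ∑ φ ∈ DD Fq n, (X : ℤ[X]) ^ fexc φ =
      ∑ m ∈ Finset.range (n + 1), (Fintype.card Fq : ℤ[X]) ^ (n - m) * ∑ ψ ∈ DD Fq m, HH ψ := by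
  have h1 : ∀ m ∈ Finset.range (n + 1),
      (Fintype.card Fq : ℤ[X]) ^ (n - m) * ∑ ψ ∈ DD Fq m, HH ψ =
        ∑ x ∈ DD Fq m ×ˢ DD Fq (n - m), HH x.1 := by
    intro m _
    rw [Finset.sum_product, Finset.mul_sum]
    refine Finset.sum_congr rfl fun ψ _ => ?_
    change _ = ∑ y ∈ DD Fq (n - m), HH ψ
    rw [Finset.sum_const, DD_card, nsmul_eq_mul]
    push_cast; rfl
  rw [Finset.sum_congr rfl h1, Finset.sum_congr rfl fun φ _ => X_pow_fexc φ, Finset.sum_sigma',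
    Finset.sum_sigma']
  refine Finset.sum_bij' (fun x _ => ⟨fdeg x.2, (x.2, x.1 - x.2)⟩)
    (fun y _ => ⟨y.2.1 + y.2.2, y.2.1⟩) ?_ ?_ ?_ ?_ ?_
  · rintro ⟨φ, ψ⟩ h
    simp only [Finset.mem_sigma, mem_below, mem_DD] at h
    have h2 : fdeg ψ + fdeg (φ - ψ) = n := by
      rw [← fdeg_add, add_tsub_cancel_of_le h.2, h.1]
    simp only [Finset.mem_sigma, Finset.mem_range, Finset.mem_product, mem_DD]
    refine ⟨by omega, trivial, by omega⟩
  · rintro ⟨m, ψ, χ⟩ h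
    simp only [Finset.mem_sigma, Finset.mem_range, Finset.mem_product, mem_DD] at h
    simp only [Finset.mem_sigma, mem_below, mem_DD]
    refine ⟨by rw [fdeg_add]; omega, le_self_add⟩
  · rintro ⟨φ, ψ⟩ h
    simp only [Finset.mem_sigma, mem_below, mem_DD] at h
    simp [add_tsub_cancel_of_le h.2]
  · rintro ⟨m, ψ, χ⟩ h
    simp only [Finset.mem_sigma, Finset.mem_range, Finset.mem_product, mem_DD] at h
    obtain ⟨_, rfl, _⟩ := h
    simp
  · rintro ⟨φ, ψ⟩ h
    rfl

theorem sum_HH (Fq : Type*) [Field Fq] [Fintype Fq] (n k : ℕ) :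
    (excessCount Fq n k : ℤ) - (Fintype.card Fq : ℤ) * (if n = 0 then 0 else
      (excessCount Fq (n - 1) k : ℤ)) = ∑ φ ∈ DD Fq n, (HH φ).coeff k := by
  cases n with
  | zero =>
    rw [excessCount_eq, sum_convolution]
    simp
  | succ n =>
    rw [excessCount_eq, sum_convolution, if_neg (by omega), Nat.add_sub_cancel, excessCount_eq,
      sum_convolution, Finset.sum_range_succ, ← finsetSum_coeff]
    have : ∑ m ∈ Finset.range (n + 1), (Fintype.card Fq : ℤ[X]) ^ (n + 1 - m) * ∑ ψ ∈ DD Fq m, HH ψ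
      = C (Fintype.card Fq : ℤ) * ∑ m ∈ Finset.range (n + 1),
        (Fintype.card Fq : ℤ[X]) ^ (n - m) * ∑ ψ ∈ DD Fq m, HH ψ := by
      rw [Finset.mul_sum]
      refine Finset.sum_congr rfl fun m hm => ?_
      rw [Finset.mem_range] at hm
      rw [show n + 1 - m = (n - m) + 1 by omega, pow_succ]
      simp only [map_natCast]
      ring
    rw [this, coeff_add, coeff_C_mul]
    simp

theorem aux_hasSum_congr {β : Type*} {f g : β → ℂ} {a : ℂ} (h : ∀ b, f b = g b)
    (hg : HasSum g a) : HasSum f a := by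
  rwa [funext h]

abbrev Fib (Fq : Type*) [Field Fq] (i : ℕ) : Type _ :=
  {p : MIrr Fq // p.1.natDegree - 1 = i}

theorem MIrr.deg_pos {Fq : Type*} [Field Fq] (p : MIrr Fq) : 0 < p.1.natDegree :=
  p.2.2.natDegree_pos

noncomputable def fibEquiv (Fq : Type*) [Field Fq] (i : ℕ) :
    Fib Fq i ≃ {p : Polynomial Fq | p.Monic ∧ Irreducible p ∧ p.natDegree = i + 1} where
  toFun p := ⟨p.1.1, p.1.2.1, p.1.2.2, by have := p.2; have := p.1.deg_pos; omega⟩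
  invFun p := ⟨⟨p.1, p.2.1, p.2.2.1⟩, by have := p.2.2.2; simp only; omega⟩
  left_inv _ := rfl
  right_inv _ := rfl

theorem fib_card (Fq : Type*) [Field Fq] (i : ℕ) : Nat.card (Fib Fq i) = nu Fq (i + 1) := by
  rw [nu, ← Nat.card_coe_set_eq, Nat.card_congr (fibEquiv Fq i)]

theorem fib_finite (Fq : Type*) [Field Fq] [Fintype Fq] (i : ℕ) : Finite (Fib Fq i) := by
  have : {p : Polynomial Fq | p.Monic ∧ Irreducible p ∧ p.natDegree = i + 1}.Finite :=
    (monic_finite Fq (i + 1)).subset fun f hf => ⟨hf.1, hf.2.2⟩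
  have := this.to_subtype
  exact Finite.of_equiv _ (fibEquiv Fq i).symm

theorem Fib.deg_eq {Fq : Type*} [Field Fq] {i : ℕ} (p : Fib Fq i) :
    p.1.1.natDegree = i + 1 := by
  have := p.2; have := p.1.deg_pos; omega

theorem summable_inv_sq (q : ℕ) (hq : 2 ≤ q) (Fq : Type*) [Field Fq] [Fintype Fq]
    (hcard : Fintype.card Fq = q) :
    Summable (fun p : MIrr Fq => (((q : ℝ) ^ p.1.natDegree)⁻¹) ^ 2) := by
  have hq0 : (0 : ℝ) < q := by positivity
  rw [← (Equiv.sigmaFiberEquiv (fun p : MIrr Fq => p.1.natDegree - 1)).summable_iff]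
  rw [summable_sigma_of_nonneg (fun x => by simp only [Function.comp]; positivity)]
  refine ⟨fun i => ?_, ?_⟩
  · have := fib_finite Fq i
    exact Summable.of_finite
  · have hgeo : Summable (fun i : ℕ => ((q : ℝ)⁻¹) ^ (i + 1)) := by
      refine (summable_nat_add_iff 1).2 (summable_geometric_of_lt_one (by positivity) ?_)
      exact inv_lt_one_of_one_lt₀ (by exact_mod_cast hq)
    refine Summable.of_nonneg_of_le (fun i => tsum_nonneg fun _ => by
      simp only [Function.comp]; positivity) (fun i => ?_) hgeo
    have := fib_finite Fq i
    have := Fintype.ofFinite (Fib Fq i)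
    have hc : ∀ p : Fib Fq i, ((fun p : MIrr Fq => (((q : ℝ) ^ p.1.natDegree)⁻¹) ^ 2) ∘
        (Equiv.sigmaFiberEquiv (fun p : MIrr Fq => p.1.natDegree - 1))) ⟨i, p⟩ =
        (((q : ℝ) ^ (i + 1))⁻¹) ^ 2 := by
      intro p
      change (((q : ℝ) ^ p.1.1.natDegree)⁻¹) ^ 2 = _
      rw [p.deg_eq]
    rw [tsum_congr hc, tsum_fintype, Finset.sum_const, Finset.card_univ, ← Nat.card_eq_fintype_card,
      fib_card, nsmul_eq_mul]
    have h1 : (nu Fq (i + 1) : ℝ) ≤ (q : ℝ) ^ (i + 1) := by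
      have := nu_le Fq (i + 1)
      rw [hcard] at this
      exact_mod_cast this
    calc _ ≤ (q : ℝ) ^ (i + 1) * (((q : ℝ) ^ (i + 1))⁻¹) ^ 2 := by gcongr
      _ = _ := by rw [inv_pow (q : ℝ) (i + 1)]; field_simp

theorem aeval_HH {Fq : Type*} [Field Fq] (x t : ℂ) (W : ℕ → ℤ[X]) (φ : MIrr Fq →₀ ℕ) :
    φ.prod (fun p m => aeval x (W m) * (((t ^ p.1.natDegree)⁻¹) ^ m)) =
      aeval x (φ.prod (fun _ m => W m)) * (t ^ fdeg φ)⁻¹ := by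
  simp only [Finsupp.prod, map_prod, Finset.prod_mul_distrib, fdeg, Finsupp.sum]
  congr 1
  rw [← Finset.prod_pow_eq_pow_sum, ← Finset.prod_inv_distrib]
  refine Finset.prod_congr rfl fun p _ => ?_
  rw [inv_pow, ← pow_mul, mul_comm]

theorem aeval_hasSum (x : ℂ) (P : ℤ[X]) :
    HasSum (fun k => (P.coeff k : ℂ) * x ^ k) (aeval x P) := by
  rw [aeval_eq_sum_range]
  have := hasSum_sum_of_ne_finset_zero (f := fun k => (P.coeff k : ℂ) * x ^ k)
    (s := Finset.range (P.natDegree + 1)) (L := .unconditional ℕ) (fun k hk => by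
      rw [Finset.mem_range, not_lt] at hk
      simp [coeff_eq_zero_of_natDegree_lt hk])
  simpa using this

section
variable {q : ℕ} {z : ℂ}

theorem key_rt (hq : 2 ≤ q) {d : ℕ} (hd : 0 < d) :
    ‖z‖ * ((q : ℝ) ^ d)⁻¹ ≤ ‖z‖ / q := by
  rw [div_eq_mul_inv]
  have hq1 : (1 : ℝ) ≤ q := by exact_mod_cast (by omega : 1 ≤ q)
  gcongr
  exact le_self_pow₀ hq1 (by omega)

theorem key_lt (hq : 2 ≤ q) (hz : ‖z‖ < q) : ‖z‖ / q < 1 := by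
  have hq1 : (0 : ℝ) < q := by positivity
  rwa [div_lt_one hq1]

theorem norm_wN (r t : ℝ) (hr : 0 ≤ r) (ht : 0 ≤ t) (hrt : r * t < 1) :
    HasSum (fun m => ‖aeval (r : ℂ) (wN (m + 1)) * (t : ℂ) ^ (m + 1)‖)
      (t ^ 2 * (1 + r) / (1 - r * t)) := by
  rw [← hasSum_nat_add_iff' 1]
  have h0 : wN (0 + 1) = 0 := rfl
  simp only [Finset.sum_range_one, h0, map_zero, zero_mul, norm_zero, sub_zero]
  have := (hasSum_geometric_of_lt_one (by positivity) hrt).mul_left (t ^ 2 * (1 + r))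
  have key : ∀ m : ℕ, ‖aeval (r : ℂ) (wN (m + 1 + 1)) * (t : ℂ) ^ (m + 1 + 1)‖ =
      t ^ 2 * (1 + r) * (r * t) ^ m := by
    intro m
    have h : aeval (r : ℂ) (wN (m + 1 + 1)) * (t : ℂ) ^ (m + 1 + 1) =
        ((t ^ 2 * (1 + r) * (r * t) ^ m : ℝ) : ℂ) := by
      simp [wN]; ring
    rw [h, Complex.norm_real, Real.norm_of_nonneg (by positivity)]
  simpa only [key, div_eq_mul_inv] using this

theorem hasSum_wP (z t : ℂ) (hrt : ‖z * t‖ < 1) :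
    HasSum (fun m => aeval z (wP m) * t ^ m) ((1 - t) * (1 + t / (1 - t * z))) := by
  have hne : 1 - t * z ≠ 0 := by
    intro h
    have : z * t = 1 := by rw [mul_comm]; exact (sub_eq_zero.1 h).symm
    rw [this, norm_one] at hrt
    exact lt_irrefl _ hrt
  rw [← hasSum_nat_add_iff' 2]
  have := (hasSum_geometric_of_norm_lt_one hrt).mul_left (t ^ 2 * (z - 1))
  have hv : (1 - t) * (1 + t / (1 - t * z)) -
      ∑ i ∈ Finset.range 2, aeval z (wP i) * t ^ i = t ^ 2 * (z - 1) * (1 - z * t)⁻¹ := by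
    have h0 : wP 0 = 1 := rfl
    have h1 : wP 1 = 0 := rfl
    rw [Finset.sum_range_succ, Finset.sum_range_one, h0, h1, mul_comm z t]
    simp only [map_one, map_zero, pow_zero]
    field_simp
    ring
  rw [hv]
  refine aux_hasSum_congr (fun m => ?_) this
  simp [wP]; ring

theorem factor_eq (z t : ℂ) (hrt : ‖z * t‖ < 1) :
    (1 - t) * (1 + t / (1 - t * z)) = 1 + t ^ 2 * (z - 1) / (1 - t * z) := by
  have hne : 1 - t * z ≠ 0 := by
    intro h
    have : z * t = 1 := by rw [mul_comm]; exact (sub_eq_zero.1 h).symm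
    rw [this, norm_one] at hrt
    exact lt_irrefl _ hrt
  field_simp
  ring

theorem norm_wP_le (z : ℂ) (m : ℕ) : ‖aeval z (wP m)‖ ≤ ‖aeval (‖z‖ : ℂ) (wN m)‖ := by
  match m with
  | 0 => simp [wP, wN]
  | 1 => simp [wP, wN]
  | m + 2 =>
    have : aeval (‖z‖ : ℂ) (wN (m + 2)) = ((‖z‖ ^ (m + 1) + ‖z‖ ^ m : ℝ) : ℂ) := by
      simp [wN]
    rw [this, Complex.norm_real, Real.norm_of_nonneg (by positivity)]
    simp only [wP, map_sub, map_pow, aeval_X]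
    refine (norm_sub_le _ _).trans ?_
    simp

end

theorem summable_majorant (q : ℕ) (hq : 2 ≤ q) (Fq : Type*) [Field Fq] [Fintype Fq]
    (hcard : Fintype.card Fq = q) (z : ℂ) (hz : ‖z‖ < q) :
    Summable (fun φ : MIrr Fq →₀ ℕ =>
      ‖φ.prod (fun p m => aeval (‖z‖ : ℂ) (wN m) * ((((q : ℂ) ^ p.1.natDegree)⁻¹) ^ m))‖) := by
  refine aux_euler_summable
    (fun (p : MIrr Fq) (m : ℕ) => aeval (‖z‖ : ℂ) (wN m) * ((((q : ℂ) ^ p.1.natDegree)⁻¹) ^ m))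
    (fun p => by simp [wN])
    (fun p : MIrr Fq => (((q : ℝ) ^ p.1.natDegree)⁻¹) ^ 2 * (1 + ‖z‖) /
      (1 - ‖z‖ * ((q : ℝ) ^ p.1.natDegree)⁻¹)) (fun p => ?_) ?_
  · have := norm_wN ‖z‖ ((q : ℝ) ^ p.1.natDegree)⁻¹ (norm_nonneg _) (by positivity)
      ((key_rt (z := z) hq p.deg_pos).trans_lt (key_lt hq hz))
    simpa using this
  · have h1 := key_lt hq hz
    refine Summable.of_nonneg_of_le (fun p => ?_) (fun p => ?_)
      ((summable_inv_sq q hq Fq hcard).mul_right ((1 + ‖z‖) / (1 - ‖z‖ / q)))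
    · have h2 := key_rt (z := z) hq p.deg_pos
      refine div_nonneg (by positivity) (by linarith)
    · have h2 := key_rt (z := z) hq p.deg_pos
      rw [mul_div_assoc]
      gcongr

theorem hasProd_MIrr (q : ℕ) (hq : 2 ≤ q) (Fq : Type*) [Field Fq] [Fintype Fq]
    (hcard : Fintype.card Fq = q) (z : ℂ) (hz : ‖z‖ < q) :
    HasProd (fun p : MIrr Fq => (1 - ((q : ℂ) ^ p.1.natDegree)⁻¹) *
      (1 + ((q : ℂ) ^ p.1.natDegree)⁻¹ / (1 - ((q : ℂ) ^ p.1.natDegree)⁻¹ * z)))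
      (∑' φ : MIrr Fq →₀ ℕ, aeval z (HH φ) * ((q : ℂ) ^ fdeg φ)⁻¹) := by
  have := aux_euler_hasProd
    (fun (p : MIrr Fq) m => aeval z (wP m) * ((((q : ℂ) ^ p.1.natDegree)⁻¹) ^ m))
    (fun p => by simp [wP]) _ (fun p => hasSum_wP z _ (by
      have := (key_rt (z := z) hq p.deg_pos).trans_lt (key_lt hq hz)
      simpa using this)) ?_
  · simpa only [aeval_HH, HH] using this
  · refine Summable.of_nonneg_of_le (fun _ => norm_nonneg _) (fun φ => ?_)
      (summable_majorant q hq Fq hcard z hz)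
    simp only [Finsupp.prod, norm_prod]
    refine Finset.prod_le_prod (fun _ _ => norm_nonneg _) fun p _ => ?_
    rw [norm_mul, norm_mul]
    gcongr
    exact norm_wP_le z _

theorem summable_pairs (q : ℕ) (hq : 2 ≤ q) (Fq : Type*) [Field Fq] [Fintype Fq]
    (hcard : Fintype.card Fq = q) (z : ℂ) (hz : ‖z‖ < q) :
    Summable (fun x : (MIrr Fq →₀ ℕ) × ℕ =>
      ((HH x.1).coeff x.2 : ℂ) * z ^ x.2 * ((q : ℂ) ^ fdeg x.1)⁻¹) := by
  let G : (MIrr Fq →₀ ℕ) → ℤ[X] := fun φ => φ.prod (fun _ m => wN m)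
  have hle : ∀ φ k, |(HH φ).coeff k| ≤ (G φ).coeff k := fun φ k =>
    aux_prod_le _ _ _ (fun _ _ => aux_wP_le _ _) k
  have hG0 : ∀ φ k, 0 ≤ (G φ).coeff k := fun φ k => (abs_nonneg _).trans (hle φ k)
  have hn : ∀ φ k, ‖((G φ).coeff k : ℂ) * (‖z‖ : ℂ) ^ k * ((q : ℂ) ^ fdeg φ)⁻¹‖ =
      ((G φ).coeff k : ℝ) * ‖z‖ ^ k * ((q : ℝ) ^ fdeg φ)⁻¹ := by
    intro φ k
    have : ((G φ).coeff k : ℂ) * (‖z‖ : ℂ) ^ k * ((q : ℂ) ^ fdeg φ)⁻¹ =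
      (((G φ).coeff k : ℝ) * ‖z‖ ^ k * ((q : ℝ) ^ fdeg φ)⁻¹ : ℝ) := by push_cast; rfl
    rw [this, Complex.norm_real, Real.norm_of_nonneg]
    have : (0 : ℝ) ≤ (G φ).coeff k := by exact_mod_cast hG0 φ k
    positivity
  have hs : ∀ φ, HasSum (fun k => ((G φ).coeff k : ℝ) * ‖z‖ ^ k * ((q : ℝ) ^ fdeg φ)⁻¹)
      ((aeval (‖z‖ : ℂ) (G φ) * ((q : ℂ) ^ fdeg φ)⁻¹).re) := by
    intro φ
    have := Complex.hasSum_re ((aeval_hasSum (‖z‖ : ℂ) (G φ)).mul_right ((q : ℂ) ^ fdeg φ)⁻¹)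
    convert this using 2 with k
    have : ((G φ).coeff k : ℂ) * (‖z‖ : ℂ) ^ k * ((q : ℂ) ^ fdeg φ)⁻¹ =
      (((G φ).coeff k : ℝ) * ‖z‖ ^ k * ((q : ℝ) ^ fdeg φ)⁻¹ : ℝ) := by push_cast; rfl
    rw [this, Complex.ofReal_re]
  have hmaj : Summable (fun x : (MIrr Fq →₀ ℕ) × ℕ =>
      ((G x.1).coeff x.2 : ℝ) * ‖z‖ ^ x.2 * ((q : ℝ) ^ fdeg x.1)⁻¹) := by
    rw [summable_prod_of_nonneg (fun x => by rw [← hn]; exact norm_nonneg _)]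
    refine ⟨fun φ => (hs φ).summable, ?_⟩
    have := summable_majorant q hq Fq hcard z hz
    simp only [aeval_HH] at this
    refine Summable.of_norm_bounded this fun φ => ?_
    rw [(hs φ).tsum_eq]
    exact Complex.abs_re_le_norm _
  refine Summable.of_norm_bounded hmaj fun x => ?_
  rw [norm_mul, norm_mul, norm_pow, norm_inv, norm_pow, Complex.norm_natCast, Complex.norm_intCast]
  gcongr
  exact_mod_cast hle x.1 x.2

theorem hasSum_main (q : ℕ) (hq : 2 ≤ q) (Fq : Type*) [Field Fq] [Fintype Fq]
    (hcard : Fintype.card Fq = q) (z : ℂ) (hz : ‖z‖ < q) :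
    HasSum (fun p : ℕ × ℕ =>
        ((excessCount Fq p.1 p.2 : ℂ) -
            q * (if p.1 = 0 then 0 else (excessCount Fq (p.1 - 1) p.2 : ℂ))) *
          ((q : ℂ) ^ p.1)⁻¹ * z ^ p.2)
      (∑' φ : MIrr Fq →₀ ℕ, aeval z (HH φ) * ((q : ℂ) ^ fdeg φ)⁻¹) := by
  have h := (summable_pairs q hq Fq hcard z hz).hasSum
  have h2 := h.prod_fiberwise (fun φ => (aeval_hasSum z (HH φ)).mul_right ((q : ℂ) ^ fdeg φ)⁻¹)
  rw [h2.tsum_eq]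
  have h3 := ((Equiv.sigmaFiberEquiv
    (fun x : (MIrr Fq →₀ ℕ) × ℕ => (fdeg x.1, x.2))).hasSum_iff).2 h
  refine h3.sigma fun nk => ?_
  obtain ⟨n, k⟩ := nk
  let e : {x : (MIrr Fq →₀ ℕ) × ℕ // (fdeg x.1, x.2) = (n, k)} ≃ {φ // φ ∈ DD Fq n} :=
    { toFun := fun x => ⟨x.1.1, mem_DD.2 (Prod.ext_iff.1 x.2).1⟩
      invFun := fun φ => ⟨(φ.1, k), by rw [mem_DD.1 φ.2]⟩
      left_inv := fun x => by
        obtain ⟨⟨φ, k'⟩, hx⟩ := x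
        obtain ⟨rfl, rfl⟩ := Prod.ext_iff.1 hx
        rfl
      right_inv := fun _ => rfl }
  rw [← e.symm.hasSum_iff]
  have h4 := (DD Fq n).hasSum (fun φ => ((HH φ).coeff k : ℂ) * z ^ k * ((q : ℂ) ^ n)⁻¹)
  have h5 := congrArg (Int.cast : ℤ → ℂ) (sum_HH Fq n k)
  rw [hcard] at h5
  push_cast at h5
  rw [← Finset.sum_mul, ← Finset.sum_mul, ← h5, mul_right_comm] at h4
  refine aux_hasSum_congr (fun φ => ?_) h4
  change ((HH φ.1).coeff k : ℂ) * z ^ k * ((q : ℂ) ^ fdeg φ.1)⁻¹ =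
      ((HH φ.1).coeff k : ℂ) * z ^ k * ((q : ℂ) ^ n)⁻¹
  rw [mem_DD.1 φ.2]

theorem summable_factor (q : ℕ) (hq : 2 ≤ q) (Fq : Type*) [Field Fq] [Fintype Fq]
    (hcard : Fintype.card Fq = q) (z : ℂ) (hz : ‖z‖ < q) :
    Summable (fun i : ℕ =>
      ‖(1 - ((q : ℂ) ^ (i + 1))⁻¹) ^ nu Fq (i + 1) *
        (1 + ((q : ℂ) ^ (i + 1))⁻¹ / (1 - ((q : ℂ) ^ (i + 1))⁻¹ * z)) ^ nu Fq (i + 1) - 1‖) := by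
  have hq0 : (0 : ℝ) < q := by positivity
  have hq1 : (1 : ℝ) < q := by exact_mod_cast hq
  have hlt := key_lt hq hz
  set K : ℝ := (‖z‖ + 1) / (1 - ‖z‖ / q) with hK
  have hK0 : 0 ≤ K := div_nonneg (by positivity) (by linarith)
  have hgeo : Summable (fun i : ℕ => ((q : ℝ)⁻¹) ^ (i + 1)) :=
    (summable_nat_add_iff 1).2 (summable_geometric_of_lt_one (by positivity)
      (inv_lt_one_of_one_lt₀ hq1))
  refine Summable.of_nonneg_of_le (fun _ => norm_nonneg _) (fun i => ?_)
    (hgeo.mul_left (K * Real.exp K))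
  set t : ℂ := ((q : ℂ) ^ (i + 1))⁻¹ with ht
  have htn : ‖t‖ = ((q : ℝ) ^ (i + 1))⁻¹ := by simp [ht]
  have hrt := key_rt (z := z) hq (Nat.succ_pos i)
  have hrt' : ‖z * t‖ ≤ ‖z‖ / q := by rw [norm_mul, htn]; exact hrt
  rw [← mul_pow, factor_eq z t (hrt'.trans_lt hlt)]
  set u : ℂ := t ^ 2 * (z - 1) / (1 - t * z) with hu
  have hun : ‖u‖ ≤ K * (((q : ℝ) ^ (i + 1))⁻¹) ^ 2 := by
    rw [hu, norm_div, norm_mul, norm_pow, htn, mul_div_assoc, mul_comm]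
    have h1 : ‖z - 1‖ ≤ ‖z‖ + 1 := by simpa using norm_sub_le z 1
    have h2 : 1 - ‖z‖ / q ≤ ‖1 - t * z‖ := by
      have := norm_sub_norm_le 1 (t * z)
      rw [norm_one, mul_comm t z] at this
      rw [mul_comm t z]
      linarith
    have h3 : 0 < 1 - ‖z‖ / q := by linarith
    rw [hK]
    gcongr
  have hnu : (nu Fq (i + 1) : ℝ) ≤ (q : ℝ) ^ (i + 1) := by
    have := nu_le Fq (i + 1)
    rw [hcard] at this
    exact_mod_cast this
  have hx : nu Fq (i + 1) * ‖u‖ ≤ K * ((q : ℝ)⁻¹) ^ (i + 1) := by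
    calc nu Fq (i + 1) * ‖u‖ ≤ (q : ℝ) ^ (i + 1) * (K * (((q : ℝ) ^ (i + 1))⁻¹) ^ 2) := by gcongr
      _ = _ := by rw [inv_pow (q : ℝ) (i + 1)]; field_simp
  have hx1 : nu Fq (i + 1) * ‖u‖ ≤ K := by
    refine hx.trans (mul_le_of_le_one_right hK0 (pow_le_one₀ (by positivity) ?_))
    exact (inv_lt_one_of_one_lt₀ hq1).le
  have hb := Finset.norm_prod_one_add_sub_one_le (Finset.range (nu Fq (i + 1))) (fun _ => u)
  simp only [Finset.prod_const, Finset.sum_const, Finset.card_range, nsmul_eq_mul] at hb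
  refine hb.trans ?_
  set x : ℝ := nu Fq (i + 1) * ‖u‖
  have hx0 : 0 ≤ x := by positivity
  have he : Real.exp x - 1 ≤ x * Real.exp x := by
    have h1 := Real.add_one_le_exp (-x)
    have h2 : Real.exp (-x) * Real.exp x = 1 := by rw [← Real.exp_add]; simp
    nlinarith [Real.exp_pos x]
  calc Real.exp x - 1 ≤ x * Real.exp x := he
    _ ≤ (K * ((q : ℝ)⁻¹) ^ (i + 1)) * Real.exp K := by gcongr
    _ = _ := by ring

theorem hasProd_nat (q : ℕ) (hq : 2 ≤ q) (Fq : Type*) [Field Fq] [Fintype Fq]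
    (hcard : Fintype.card Fq = q) (z : ℂ) (hz : ‖z‖ < q) :
    HasProd (fun i : ℕ => (1 - ((q : ℂ) ^ (i + 1))⁻¹) ^ nu Fq (i + 1) *
        (1 + ((q : ℂ) ^ (i + 1))⁻¹ / (1 - ((q : ℂ) ^ (i + 1))⁻¹ * z)) ^ nu Fq (i + 1))
      (∑' φ : MIrr Fq →₀ ℕ, aeval z (HH φ) * ((q : ℂ) ^ fdeg φ)⁻¹) := by
  have h := ((Equiv.sigmaFiberEquiv (fun p : MIrr Fq => p.1.natDegree - 1)).hasProd_iff).2
    (hasProd_MIrr q hq Fq hcard z hz)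
  refine h.sigma fun i => ?_
  have := fib_finite Fq i
  have := Fintype.ofFinite (Fib Fq i)
  have h1 := hasProd_fintype (fun _ : Fib Fq i => (1 - ((q : ℂ) ^ (i + 1))⁻¹) *
        (1 + ((q : ℂ) ^ (i + 1))⁻¹ / (1 - ((q : ℂ) ^ (i + 1))⁻¹ * z)))
  rw [Finset.prod_const, Finset.card_univ, ← Nat.card_eq_fintype_card, fib_card, mul_pow] at h1
  convert h1 using 1
  funext p
  change (1 - ((q : ℂ) ^ p.1.1.natDegree)⁻¹) * (1 + ((q : ℂ) ^ p.1.1.natDegree)⁻¹ /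
    (1 - ((q : ℂ) ^ p.1.1.natDegree)⁻¹ * z)) = _
  rw [Fib.deg_eq p]

/-- for `|z| < √q`, the double series
`∑_{n,k} (e_{n,k} - q e_{n-1,k}) q^{-n} z^k` (with `e_{-1,k} = 0`) converges and equals
the absolutely convergent product `∏_{i≥1} (1 - q^{-i})^{ν_i} (1 + q^{-i}/(1 - q^{-i} z))^{ν_i}`. -/
theorem telescoping_identity (q : ℕ) (hq : 2 ≤ q) (Fq : Type*) [Field Fq] [Fintype Fq]
    (hcard : Fintype.card Fq = q) (z : ℂ) (hz : ‖z‖ < Real.sqrt q) :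
    Summable (fun i : ℕ =>
      ‖(1 - ((q : ℂ) ^ (i + 1))⁻¹) ^ nu Fq (i + 1) *
        (1 + ((q : ℂ) ^ (i + 1))⁻¹ / (1 - ((q : ℂ) ^ (i + 1))⁻¹ * z)) ^ nu Fq (i + 1) - 1‖) ∧
    HasSum (fun p : ℕ × ℕ =>
        ((excessCount Fq p.1 p.2 : ℂ) -
            q * (if p.1 = 0 then 0 else (excessCount Fq (p.1 - 1) p.2 : ℂ))) *
          ((q : ℂ) ^ p.1)⁻¹ * z ^ p.2)
      (∏' i : ℕ, (1 - ((q : ℂ) ^ (i + 1))⁻¹) ^ nu Fq (i + 1) *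
        (1 + ((q : ℂ) ^ (i + 1))⁻¹ / (1 - ((q : ℂ) ^ (i + 1))⁻¹ * z)) ^ nu Fq (i + 1)) := by
  have hz' : ‖z‖ < q := by
    have h1 : (1 : ℝ) ≤ q := by exact_mod_cast (by omega : 1 ≤ q)
    refine hz.trans_le (Real.sqrt_le_iff.2 ⟨by positivity, ?_⟩)
    nlinarith
  refine ⟨summable_factor q hq Fq hcard z hz', ?_⟩
  rw [(hasProd_nat q hq Fq hcard z hz').tprod_eq]
  exact hasSum_main q hq Fq hcard z hz'
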